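/- arXiv:1601.00823 — 3 statements merged into one kernel-verified Lean document; each statement's English description precedes it below -/
import Mathlib

section
/- Let p be a monic irreducible polynomial of degree n over a field K and let k ≥ 1. Then, over K(s), (sI − J(p^k))^{−1} = π₋( (p·I_k − N_k)^{−1} ⊗ (b(s) b(s)ᵀ M) ), where ⊗ is the Kronecker product of matrices over K(s) and π₋ is applied entrywise. -/
open Polynomial Matrix Kronecker

set_option synthInstance.maxHeartbeats 1000000
set_option maxHeartbeats 1000000

noncomputable section

variable {K : Type*} [Field K]

/-- The strictly proper part of a rational function. -/
def piMinus (f : RatFunc K) : RatFunc K :=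
  f - algebraMap (Polynomial K) (RatFunc K) (f.num /ₘ f.denom)

/-- A rational function is strictly proper. -/
def IsStrictlyProper (f : RatFunc K) : Prop :=
  f.num.degree < f.denom.degree

/-- Companion matrix of a polynomial, for size `n`. -/
def companion (n : ℕ) (p : Polynomial K) : Matrix (Fin n) (Fin n) K :=
  Matrix.of fun i j =>
    if (i : ℕ) + 1 = (j : ℕ) then 1
    else if (i : ℕ) = n - 1 then -(p.coeff (j : ℕ)) else 0

/-- The Hankel matrix `M(p)`. -/
def hankelM (n : ℕ) (p : Polynomial K) : Matrix (Fin n) (Fin n) K :=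
  Matrix.of fun i j =>
    if (i : ℕ) + (j : ℕ) + 1 ≤ n then p.coeff ((i : ℕ) + (j : ℕ) + 1) else 0

/-- The matrix `N_k` with ones on the superdiagonal. -/
def supN (R : Type*) [Semiring R] (k : ℕ) : Matrix (Fin k) (Fin k) R :=
  Matrix.of fun i j => if (i : ℕ) + 1 = (j : ℕ) then 1 else 0

/-- `V = eₙ e₁ᵀ`. -/
def eV (K : Type*) [Field K] (n : ℕ) : Matrix (Fin n) (Fin n) K :=
  Matrix.of fun i j => if (i : ℕ) = n - 1 ∧ (j : ℕ) = 0 then 1 else 0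

/-- Jacobson block `J(p^k)`, as an `nk × nk` matrix indexed by `Fin k × Fin n`. -/
def jacobson (n : ℕ) (p : Polynomial K) (k : ℕ) :
    Matrix (Fin k × Fin n) (Fin k × Fin n) K :=
  (1 : Matrix (Fin k) (Fin k) K) ⊗ₖ companion n p + supN K k ⊗ₖ eV K n

/-- `sI - F` as a matrix over `K(s)`. -/
def sISub {ι : Type*} [Fintype ι] [DecidableEq ι] (F : Matrix ι ι K) :
    Matrix ι ι (RatFunc K) :=
  Matrix.diagonal (fun _ => (RatFunc.X : RatFunc K)) - F.map (algebraMap K (RatFunc K))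

/-- `b(s) = (1, s, …, s^{n-1})ᵀ` as a vector over `K(s)`. -/
def bVec (K : Type*) [Field K] (n : ℕ) : Fin n → RatFunc K :=
  fun i => (RatFunc.X : RatFunc K) ^ (i : ℕ)

/-- The rank-one matrix `b(s) b(s)ᵀ`. -/
def bbT (K : Type*) [Field K] (n : ℕ) : Matrix (Fin n) (Fin n) (RatFunc K) :=
  Matrix.of fun i j => bVec K n i * bVec K n j

/-- The polynomial quotient of `p` by `X ^ (j + 1)`, for `p` of degree at most `n`. -/
def shiftedPoly (n : ℕ) (p : Polynomial K) (j : ℕ) : Polynomial K :=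
  ∑ l ∈ Finset.range n, C (p.coeff (l + j + 1)) * Polynomial.X ^ l

/-- The polynomial part of `b(s) b(s)ᵀ M / p`. -/
def polyPart (K : Type*) [Field K] (n : ℕ) : Matrix (Fin n) (Fin n) (Polynomial K) :=
  Matrix.of fun i j => if (j : ℕ) < i then Polynomial.X ^ ((i : ℕ) - j - 1) else 0

/-- The closed form of `(x I - N)⁻¹`. -/
def supNResolvent {F : Type*} [Field F] (k : ℕ) (x : F) : Matrix (Fin k) (Fin k) F :=
  Matrix.of fun a b => if (a : ℕ) ≤ b then (x ^ ((b : ℕ) - a + 1))⁻¹ else 0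

lemma piMinus_eq_sub {f : RatFunc K} {y r d : Polynomial K} (hd : d.Monic)
    (hr : r.degree < d.degree)
    (hf : f = algebraMap (Polynomial K) (RatFunc K) y +
      algebraMap (Polynomial K) (RatFunc K) r / algebraMap (Polynomial K) (RatFunc K) d) :
    piMinus f = f - algebraMap (Polynomial K) (RatFunc K) y := by
  have hd0 : algebraMap (Polynomial K) (RatFunc K) d ≠ 0 :=
    RatFunc.algebraMap_ne_zero hd.ne_zero
  have hden : algebraMap (Polynomial K) (RatFunc K) f.denom ≠ 0 :=
    RatFunc.algebraMap_ne_zero f.denom_ne_zero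
  have key : (f.num - f.denom * y) * d = r * f.denom := by
    apply RatFunc.algebraMap_injective K
    have h := RatFunc.num_div_denom f
    rw [div_eq_iff hden] at h
    simp only [map_mul, map_sub, h]
    nth_rewrite 1 [hf]
    field_simp
    ring
  have hlt : (f.num - f.denom * y).degree < f.denom.degree := by
    have hdeg := congrArg Polynomial.degree key
    rw [degree_mul, degree_mul] at hdeg
    by_contra! hle
    have h1 : r.degree + f.denom.degree < d.degree + f.denom.degree :=
      WithBot.add_lt_add_right (degree_ne_bot.mpr f.denom_ne_zero) hr
    have h2 : f.denom.degree + d.degree ≤ (f.num - f.denom * y).degree + d.degree := by gcongr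
    rw [hdeg, add_comm] at h2
    exact absurd h1 (not_lt.mpr h2)
  rw [piMinus, (div_modByMonic_unique y (f.num - f.denom * y) (RatFunc.monic_denom f)
    ⟨by ring, hlt⟩).1]

lemma coeff_shiftedPoly {n : ℕ} {p : Polynomial K} (h : p.natDegree ≤ n) (j m : ℕ) :
    (shiftedPoly n p j).coeff m = p.coeff (m + j + 1) := by
  simp only [shiftedPoly, finsetSum_coeff, coeff_C_mul, coeff_X_pow, mul_ite, mul_one, mul_zero,
    Finset.sum_ite_eq, Finset.mem_range]
  split_ifs with hm
  · rfl
  · exact (coeff_eq_zero_of_natDegree_lt (by omega)).symm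

lemma degree_X_pow_mul_shiftedPoly_lt {n : ℕ} {p : Polynomial K} (h : p.natDegree ≤ n)
    {i j N : ℕ} (hN : i + n ≤ N + j) :
    (Polynomial.X ^ i * shiftedPoly n p j).degree < (N : WithBot ℕ) := by
  rw [degree_lt_iff_coeff_zero]
  intro m hm
  rw [coeff_X_pow_mul']
  split_ifs with him
  · rw [coeff_shiftedPoly h]
    exact coeff_eq_zero_of_natDegree_lt (by omega)
  · rfl

lemma degree_X_pow_mul_shiftedPoly_sub_lt {n : ℕ} {p : Polynomial K} (h : p.natDegree ≤ n)
    (i j : Fin n) :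
    (Polynomial.X ^ (i : ℕ) * shiftedPoly n p j - polyPart K n i j * p).degree < (n : WithBot ℕ) := by
  by_cases hij : (j : ℕ) < i
  · rw [degree_lt_iff_coeff_zero]
    intro m hm
    simp only [polyPart, of_apply, if_pos hij, coeff_sub]
    rw [coeff_X_pow_mul', coeff_X_pow_mul', if_pos (by omega), if_pos (by omega),
      coeff_shiftedPoly h, sub_eq_zero]
    congr 1
    omega
  · have hle : (i : ℕ) + n ≤ n + j := by omega
    simpa only [polyPart, of_apply, if_neg hij, zero_mul, sub_zero] using
      degree_X_pow_mul_shiftedPoly_lt h hle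

lemma supN_mul_apply {R : Type*} [Semiring R] {k : ℕ} {m : Type*} (A : Matrix (Fin k) m R)
    (a : Fin k) (b : m) :
    (supN R k * A) a b = if h : (a : ℕ) + 1 < k then A ⟨a + 1, h⟩ b else 0 := by
  simp only [supN, mul_apply, of_apply, ite_mul, one_mul, zero_mul]
  split_ifs with h
  · rw [Finset.sum_eq_single ⟨a + 1, h⟩]
    · simp
    · intro c _ hc
      rw [if_neg]
      exact fun hac => hc (Fin.ext hac.symm)
    · simp
  · exact Finset.sum_eq_zero fun c _ => if_neg (by omega)

lemma smul_one_sub_supN_mul_supNResolvent {F : Type*} [Field F] (k : ℕ) {x : F} (hx : x ≠ 0) :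
    (x • (1 : Matrix (Fin k) (Fin k) F) - supN F k) * supNResolvent k x = 1 := by
  ext a b
  rw [sub_mul, smul_mul_assoc, one_mul, Matrix.sub_apply, Matrix.smul_apply, supN_mul_apply, smul_eq_mul,
    Matrix.one_apply]
  simp only [supNResolvent, of_apply, Fin.ext_iff]
  rcases lt_trichotomy (a : ℕ) b with hab | hab | hab
  · have hk : (a : ℕ) + 1 < k := by omega
    rw [if_pos hab.le, dif_pos hk, if_pos (by omega), if_neg (by omega),
      show (b : ℕ) - (a + 1) + 1 = b - a by omega, pow_succ]
    field_simp
    simp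
  · rw [if_pos hab.le, if_pos hab, hab]
    simp [hx]
  · rw [if_neg (by omega), if_neg (by omega)]
    split_ifs <;> first | omega | simp

lemma bbT_mul_hankelM_apply (n : ℕ) (p : Polynomial K) (h : p.natDegree ≤ n) (i j : Fin n) :
    (bbT K n * (hankelM n p).map (algebraMap K (RatFunc K))) i j =
      algebraMap (Polynomial K) (RatFunc K) (Polynomial.X ^ (i : ℕ) * shiftedPoly n p j) := by
  simp only [mul_apply, bbT, bVec, of_apply, hankelM, Matrix.map_apply, shiftedPoly, map_mul, map_sum,
    map_pow, RatFunc.algebraMap_X, RatFunc.algebraMap_C, Finset.mul_sum]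
  rw [← Fin.sum_univ_eq_sum_range (fun l => RatFunc.X ^ (i : ℕ) *
    (RatFunc.C (p.coeff (l + j + 1)) * RatFunc.X ^ l))]
  refine Finset.sum_congr rfl fun l _ => ?_
  rw [← RatFunc.algebraMap_eq_C]
  split_ifs with hl
  · ring
  · rw [coeff_eq_zero_of_natDegree_lt (by omega)]
    simp

lemma sISub_companion_mul_apply_of_lt {n : ℕ} (p : Polynomial K) {m : Type*}
    (A : Matrix (Fin n) m (RatFunc K)) {i : Fin n} (j : m) (hi : (i : ℕ) + 1 < n) :
    (sISub (companion n p) * A) i j = RatFunc.X * A i j - A ⟨i + 1, hi⟩ j := by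
  rw [sISub, Matrix.sub_mul, Matrix.sub_apply, diagonal_mul, mul_apply, Finset.sum_eq_single ⟨i + 1, hi⟩]
  · simp [companion]
  · intro c _ hc
    have hic : (i : ℕ) + 1 ≠ c := fun hic => hc (Fin.ext hic.symm)
    have hin : (i : ℕ) ≠ n - 1 := by omega
    simp [companion, hic, hin]
  · simp

lemma sISub_companion_mul_apply_of_eq {n : ℕ} (p : Polynomial K) {m : Type*}
    (A : Matrix (Fin n) m (RatFunc K)) {i : Fin n} (j : m) (hi : (i : ℕ) + 1 = n) :
    (sISub (companion n p) * A) i j =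
      RatFunc.X * A i j + ∑ l : Fin n, algebraMap K (RatFunc K) (p.coeff l) * A l j := by
  rw [sISub, Matrix.sub_mul, Matrix.sub_apply, diagonal_mul, mul_apply, sub_eq_add_neg,
    ← Finset.sum_neg_distrib]
  congr 1
  refine Finset.sum_congr rfl fun l _ => ?_
  have hil : (i : ℕ) + 1 ≠ l := by omega
  have hin : (i : ℕ) = n - 1 := by omega
  simp only [companion, Matrix.map_apply, of_apply, if_neg hil, if_pos hin, map_neg, neg_mul, neg_neg]

lemma sISub_companion_mul_bbT_mul (n : ℕ) {p : Polynomial K} (hp : p.Monic)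
    (hdeg : p.natDegree = n) (A : Matrix (Fin n) (Fin n) (RatFunc K)) :
    sISub (companion n p) * (bbT K n * A) =
      algebraMap (Polynomial K) (RatFunc K) p •
        ((eV K n).map (algebraMap K (RatFunc K)) * (bbT K n * A)) := by
  rw [← Matrix.mul_assoc, ← Matrix.mul_assoc, ← smul_mul_assoc]
  congr 1
  ext i j
  have hn : 0 < n := i.pos
  have hV : ((eV K n).map (algebraMap K (RatFunc K)) * bbT K n) i j =
      if (i : ℕ) = n - 1 then RatFunc.X ^ (j : ℕ) else 0 := by
    rw [mul_apply, Finset.sum_eq_single ⟨0, hn⟩]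
    · by_cases h : (i : ℕ) = n - 1 <;> simp [eV, bbT, bVec, h]
    · intro c _ hc
      have hc0 : (c : ℕ) ≠ 0 := fun h => hc (Fin.ext h)
      simp [eV, hc0]
    · simp
  rw [Matrix.smul_apply, hV]
  rcases (show (i : ℕ) + 1 ≤ n from i.2).lt_or_eq with hi | hi
  · rw [sISub_companion_mul_apply_of_lt p _ j hi, if_neg (by omega)]
    simp only [bbT, bVec, of_apply, smul_zero]
    ring
  · rw [sISub_companion_mul_apply_of_eq p _ j hi, if_pos (by omega)]
    simp only [bbT, bVec, of_apply]
    conv_rhs => rw [hp.as_sum]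
    rw [← Fin.sum_univ_eq_sum_range (fun l => C (p.coeff l) * Polynomial.X ^ l), hdeg, smul_eq_mul]
    simp only [map_add, map_pow, map_sum, map_mul, RatFunc.algebraMap_X, RatFunc.algebraMap_C,
      RatFunc.algebraMap_eq_C, add_mul, Finset.sum_mul]
    congr 1
    · rw [← mul_assoc, ← pow_succ', hi]
    · exact Finset.sum_congr rfl fun l _ => by ring

lemma eV_mul_bbT_mul_hankelM_apply (n : ℕ) (p : Polynomial K) (h : p.natDegree ≤ n)
    (i j : Fin n) :
    ((eV K n).map (algebraMap K (RatFunc K)) *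
      (bbT K n * (hankelM n p).map (algebraMap K (RatFunc K)))) i j =
      if (i : ℕ) = n - 1 then algebraMap (Polynomial K) (RatFunc K) (shiftedPoly n p j) else 0 := by
  have hn : 0 < n := i.pos
  rw [mul_apply, Finset.sum_eq_single ⟨0, hn⟩]
  · rw [bbT_mul_hankelM_apply n p h]
    by_cases h : (i : ℕ) = n - 1 <;> simp [eV, h]
  · intro c _ hc
    have hc0 : (c : ℕ) ≠ 0 := fun h => hc (Fin.ext h)
    simp [eV, hc0]
  · simp

lemma eV_mul_polyPart (n : ℕ) :
    (eV K n).map (algebraMap K (RatFunc K)) *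
      (polyPart K n).map (algebraMap (Polynomial K) (RatFunc K)) = 0 := by
  ext i j
  rw [mul_apply]
  refine Finset.sum_eq_zero fun c _ => ?_
  by_cases hc : (c : ℕ) = 0
  · have hjc : ¬ (j : ℕ) < c := by omega
    simp only [polyPart, Matrix.map_apply, of_apply, if_neg hjc, map_zero, mul_zero]
  · simp [eV, hc]

lemma shiftedPoly_eq_sum {n : ℕ} {p : Polynomial K} (hp : p.Monic) (hdeg : p.natDegree = n)
    {j : ℕ} (hj : j < n) :
    shiftedPoly n p j = Polynomial.X ^ (n - j - 1) +
      ∑ l ∈ Finset.range n,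
        C (p.coeff l) * (if j < l then Polynomial.X ^ (l - j - 1) else 0) := by
  have hlead : p.coeff n = 1 := hdeg ▸ hp.coeff_natDegree
  have h : shiftedPoly n p j = ∑ l ∈ Finset.range (n + 1),
      C (p.coeff l) * (if j < l then Polynomial.X ^ (l - j - 1) else 0) := by
    have h1 : n + 1 = (j + 1) + (n - j) := by omega
    rw [h1, Finset.sum_range_add, Finset.sum_eq_zero, zero_add, shiftedPoly]
    · have h2 : n = (n - j) + j := by omega
      conv_lhs => rw [h2, Finset.sum_range_add]
      rw [add_eq_left.mpr]
      · refine Finset.sum_congr rfl fun l _ => ?_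
        rw [if_pos (by omega), show j + 1 + l - j - 1 = l by omega,
          show j + 1 + l = l + j + 1 by omega]
      · refine Finset.sum_eq_zero fun l _ => ?_
        rw [coeff_eq_zero_of_natDegree_lt (by omega), C_0, zero_mul]
    · intro l hl
      rw [Finset.mem_range] at hl
      rw [if_neg (by omega), mul_zero]
  rw [h, Finset.sum_range_succ, hlead, if_pos hj, C_1, one_mul, add_comm]

lemma sISub_companion_mul_polyPart (n : ℕ) {p : Polynomial K} (hp : p.Monic)
    (hdeg : p.natDegree = n) :
    sISub (companion n p) * (polyPart K n).map (algebraMap (Polynomial K) (RatFunc K)) =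
      (eV K n).map (algebraMap K (RatFunc K)) *
        (bbT K n * (hankelM n p).map (algebraMap K (RatFunc K))) - 1 := by
  ext i j
  rw [Matrix.sub_apply, eV_mul_bbT_mul_hankelM_apply n p hdeg.le, Matrix.one_apply]
  simp only [Fin.ext_iff]
  rcases (show (i : ℕ) + 1 ≤ n from i.2).lt_or_eq with hi | hi
  · rw [sISub_companion_mul_apply_of_lt p _ j hi, if_neg (by omega)]
    simp only [polyPart, Matrix.map_apply, of_apply]
    rcases lt_trichotomy (i : ℕ) j with hij | hij | hij
    · rw [if_neg (by omega), if_neg (by omega), if_neg (by omega)]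
      simp
    · rw [if_neg (by omega), if_pos (by omega), if_pos hij, hij]
      simp
    · rw [if_pos hij, if_pos (by omega), if_neg (by omega),
        show (i : ℕ) + 1 - j - 1 = (i - j - 1) + 1 by omega]
      simp only [map_pow, RatFunc.algebraMap_X]
      ring
  · rw [sISub_companion_mul_apply_of_eq p _ j hi, if_pos (by omega),
      shiftedPoly_eq_sum hp hdeg j.2, ← Fin.sum_univ_eq_sum_range
      (fun l => C (p.coeff l) * (if (j : ℕ) < l then Polynomial.X ^ (l - j - 1) else 0))]
    simp only [polyPart, Matrix.map_apply, of_apply, map_add, map_sum, map_mul, map_pow,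
      RatFunc.algebraMap_X, RatFunc.algebraMap_C, RatFunc.algebraMap_eq_C]
    rw [add_sub_right_comm]
    congr 1
    by_cases hij : (j : ℕ) < i
    · rw [if_pos hij, if_neg (by omega), show n - (j : ℕ) - 1 = (i - j - 1) + 1 by omega]
      simp only [map_pow, RatFunc.algebraMap_X]
      ring
    · rw [if_neg hij, if_pos (by omega), show n - (j : ℕ) - 1 = 0 by omega]
      simp

lemma sISub_jacobson (n : ℕ) (p : Polynomial K) (k : ℕ) :
    sISub (jacobson n p k) = (1 : Matrix (Fin k) (Fin k) (RatFunc K)) ⊗ₖ sISub (companion n p) -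
      supN (RatFunc K) k ⊗ₖ (eV K n).map (algebraMap K (RatFunc K)) := by
  ext ⟨a, i⟩ ⟨b, j⟩
  simp only [sISub, jacobson, supN, Matrix.sub_apply, Matrix.map_apply, Matrix.add_apply, kroneckerMap_apply,
    diagonal_apply, Matrix.one_apply, of_apply, Prod.mk.injEq, map_add, map_mul]
  by_cases hab : a = b <;> by_cases hij : i = j <;> by_cases h : (a : ℕ) + 1 = b <;>
    simp [hab, hij, h]

lemma map_piMinus_supNResolvent_kronecker (n : ℕ) {p : Polynomial K} (hp : p.Monic)
    (hdeg : p.natDegree = n) (k : ℕ) :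
    (supNResolvent k (algebraMap (Polynomial K) (RatFunc K) p) ⊗ₖ
      (bbT K n * (hankelM n p).map (algebraMap K (RatFunc K)))).map piMinus =
      supNResolvent k (algebraMap (Polynomial K) (RatFunc K) p) ⊗ₖ
        (bbT K n * (hankelM n p).map (algebraMap K (RatFunc K))) -
      (1 : Matrix (Fin k) (Fin k) (RatFunc K)) ⊗ₖ
        (polyPart K n).map (algebraMap (Polynomial K) (RatFunc K)) := by
  have hp0 : algebraMap (Polynomial K) (RatFunc K) p ≠ 0 :=
    RatFunc.algebraMap_ne_zero hp.ne_zero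
  have hpdeg : p.degree = n := by rw [degree_eq_natDegree hp.ne_zero, hdeg]
  ext ⟨a, i⟩ ⟨b, j⟩
  rw [Matrix.map_apply, Matrix.sub_apply, kroneckerMap_apply, kroneckerMap_apply,
    bbT_mul_hankelM_apply n p hdeg.le, Matrix.map_apply, Matrix.one_apply]
  simp only [supNResolvent, of_apply]
  rcases lt_trichotomy a b with hab | rfl | hab
  · rw [if_pos (Fin.le_def.mp hab.le), if_neg hab.ne, zero_mul]
    have hle : 2 ≤ (b : ℕ) - a + 1 := by
      have := Fin.lt_def.mp hab
      omega
    rw [piMinus_eq_sub (y := 0) (r := Polynomial.X ^ (i : ℕ) * shiftedPoly n p j)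
      (hp.pow ((b : ℕ) - a + 1)), map_zero]
    · have h2 : i + n ≤ ((b : ℕ) - a + 1) * n + j := by nlinarith [i.2]
      have h3 := degree_X_pow_mul_shiftedPoly_lt hdeg.le h2
      rwa [degree_pow, hpdeg, nsmul_eq_mul, ← Nat.cast_mul]
    · rw [map_zero, zero_add, map_pow, div_eq_mul_inv, mul_comm]
  · rw [if_pos le_rfl, if_pos rfl, one_mul]
    refine piMinus_eq_sub hp
      (hpdeg ▸ degree_X_pow_mul_shiftedPoly_sub_lt hdeg.le i j) ?_
    rw [map_sub, map_mul _ (polyPart K n i j)]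
    simp only [Nat.sub_self, zero_add, pow_one]
    field_simp
    ring
  · rw [if_neg (not_le.mpr (Fin.lt_def.mp hab)), if_neg hab.ne', zero_mul, zero_mul]
    simp [piMinus]

/-- `(sI - J(p^k))⁻¹ = π₋( (p Iₖ - Nₖ)⁻¹ ⊗ (b(s) b(s)ᵀ M) )`, entrywise. -/
theorem jacobson_resolvent_eq_piMinus (n : ℕ) (hn : 1 ≤ n) (p : Polynomial K)
    (hp : p.Monic) (hirr : Irreducible p) (hdeg : p.natDegree = n)
    (k : ℕ) (hk : 1 ≤ k) :
    (sISub (jacobson n p k))⁻¹ =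
      (((algebraMap (Polynomial K) (RatFunc K) p •
            (1 : Matrix (Fin k) (Fin k) (RatFunc K)) - supN (RatFunc K) k)⁻¹ ⊗ₖ
        (bbT K n * (hankelM n p).map (algebraMap K (RatFunc K)))).map piMinus) := by
  have hp0 : algebraMap (Polynomial K) (RatFunc K) p ≠ 0 :=
    RatFunc.algebraMap_ne_zero hp.ne_zero
  have hU := smul_one_sub_supN_mul_supNResolvent k hp0
  rw [inv_eq_right_inv hU, map_piMinus_supNResolvent_kronecker n hp hdeg k]
  refine inv_eq_right_inv ?_
  rw [sISub_jacobson, sub_mul, mul_sub, mul_sub]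
  simp only [← mul_kronecker_mul]
  rw [sISub_companion_mul_bbT_mul n hp hdeg, eV_mul_polyPart,
    sISub_companion_mul_polyPart n hp hdeg, kronecker_zero, sub_zero, kronecker_smul,
    ← smul_kronecker, Matrix.one_mul, Matrix.one_mul]
  rw [sub_mul, smul_mul_assoc, Matrix.one_mul, sub_eq_iff_eq_add] at hU
  rw [hU, add_kronecker, sub_eq_add_neg _ (1 : Matrix (Fin n) (Fin n) (RatFunc K)),
    kronecker_add, ← one_kronecker_one (m := Fin k) (n := Fin n)]
  ext x y
  simp only [Matrix.sub_apply, Matrix.add_apply, kroneckerMap_apply, Matrix.neg_apply]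
  ring

end
end

section
/- Let C be the n×n companion matrix of a monic polynomial p of degree n over a field K. Then for every integer j ≥ 0, π₋( s^j · (sI − C)^{−1} ) = C^j · (sI − C)^{−1} over K(s), where π₋ is applied entrywise. -/
open Polynomial Matrix Kronecker

set_option synthInstance.maxHeartbeats 1000000
set_option maxHeartbeats 1000000

noncomputable section

variable {K : Type*} [Field K]

open Classical in
theorem inftyValuation_algebraMap_le_one (c : K) :
    RatFunc.inftyValuation K (algebraMap K (RatFunc K) c) ≤ 1 := by
  rcases eq_or_ne c 0 with rfl | hc
  · simp
  · rw [RatFunc.algebraMap_eq_C, RatFunc.inftyValuation.C K hc]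

open Classical in
theorem eq_zero_of_inftyValuation_algebraMap_lt_one {q : K[X]}
    (hq : RatFunc.inftyValuation K (algebraMap K[X] (RatFunc K) q) < 1) : q = 0 := by
  by_contra h
  rw [RatFunc.inftyValuation_apply, RatFunc.inftyValuation.polynomial K h,
    ← WithZero.exp_zero, WithZero.exp_lt_exp] at hq
  omega

open Classical in
theorem inftyValuation_piMinus_lt_one (f : RatFunc K) :
    RatFunc.inftyValuation K (piMinus f) < 1 := by
  have hd : algebraMap K[X] (RatFunc K) f.denom ≠ 0 := by simpa using f.denom_ne_zero
  have hf : piMinus f = algebraMap K[X] (RatFunc K) (f.num %ₘ f.denom) /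
      algebraMap K[X] (RatFunc K) f.denom := by
    rw [eq_div_iff hd, piMinus, sub_mul]
    nth_rw 1 [← RatFunc.num_div_denom f]
    rw [div_mul_cancel₀ _ hd, ← map_mul, ← map_sub, modByMonic_eq_sub_mul_div, mul_comm]
  rw [hf]
  rcases eq_or_ne (f.num %ₘ f.denom) 0 with h | h
  · simp [h]
  · have hdeg := natDegree_lt_natDegree h (degree_modByMonic_lt f.num f.monic_denom)
    rw [map_div₀, RatFunc.inftyValuation_apply, RatFunc.inftyValuation_apply,
      RatFunc.inftyValuation.polynomial K h, RatFunc.inftyValuation.polynomial K f.denom_ne_zero,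
      ← WithZero.exp_sub, ← WithZero.exp_zero, WithZero.exp_lt_exp]
    omega

open Classical in
/-- The strictly proper part is the unique strictly proper function differing from `f` by a
polynomial. -/
theorem piMinus_eq_of_sub_eq_algebraMap {f w : RatFunc K} {y : K[X]}
    (hw : RatFunc.inftyValuation K w < 1) (h : f - w = algebraMap K[X] (RatFunc K) y) :
    piMinus f = w := by
  have key : piMinus f - w = algebraMap K[X] (RatFunc K) (y - f.num /ₘ f.denom) := by
    rw [map_sub, ← h, piMinus]
    ring
  have hlt := Valuation.map_sub_lt _ (inftyValuation_piMinus_lt_one f) hw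
  rw [key] at hlt
  rw [← sub_eq_zero, key, eq_zero_of_inftyValuation_algebraMap_lt_one hlt, map_zero]

section Resolvent

variable {ι : Type*} [Fintype ι]

open Classical in
theorem inftyValuation_map_mul_apply_le (A : Matrix ι ι K) (R : Matrix ι ι (RatFunc K))
    {g : WithZero (Multiplicative ℤ)} (hR : ∀ i k, RatFunc.inftyValuation K (R i k) ≤ g) (i k : ι) :
    RatFunc.inftyValuation K ((A.map (algebraMap K (RatFunc K)) * R) i k) ≤ g := by
  rw [mul_apply]
  refine Valuation.map_sum_le _ fun l _ => ?_
  rw [map_mul]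
  exact mul_le_of_le_one_of_le (inftyValuation_algebraMap_le_one _) (hR l k)

variable [DecidableEq ι]

theorem sISub_eq_charmatrix_map (F : Matrix ι ι K) :
    sISub F = (algebraMap K[X] (RatFunc K)).mapMatrix (charmatrix F) := by
  ext i k
  rcases eq_or_ne i k with rfl | h
  · simp [sISub]
  · simp [sISub, h]

theorem isUnit_det_sISub (F : Matrix ι ι K) : IsUnit (sISub F).det := by
  rw [sISub_eq_charmatrix_map, ← RingHom.map_det, isUnit_iff_ne_zero]
  exact (map_ne_zero_iff _ (RatFunc.algebraMap_injective K)).mpr F.charpoly_monic.ne_zero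

open Classical in
theorem exists_inftyValuation_resolvent_le (F : Matrix ι ι K) :
    ∃ g < 1, ∀ i k, RatFunc.inftyValuation K ((sISub F)⁻¹ i k) ≤ g := by
  rcases isEmpty_or_nonempty ι with _ | _
  · exact ⟨0, zero_lt_one, fun i => isEmptyElim i⟩
  obtain ⟨⟨a, b⟩, hab⟩ := Finite.exists_max
    fun x : ι × ι => RatFunc.inftyValuation K ((sISub F)⁻¹ x.1 x.2)
  refine ⟨_, ?_, fun i k => hab (i, k)⟩
  by_contra! hge
  have hmul := congrFun₂ (mul_nonsing_inv (sISub F) (isUnit_det_sISub F)) a b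
  nth_rw 1 [sISub] at hmul
  rw [sub_mul, Matrix.sub_apply, diagonal_mul, sub_eq_iff_eq_add] at hmul
  have hone : RatFunc.inftyValuation K ((1 : Matrix ι ι (RatFunc K)) a b) ≤ 1 := by
    rw [one_apply]
    split_ifs <;> simp
  have hle := Valuation.map_add_le (RatFunc.inftyValuation K) (hone.trans hge)
    (inftyValuation_map_mul_apply_le F _ (fun i k => hab (i, k)) a b)
  rw [← hmul, map_mul, RatFunc.inftyValuation.X] at hle
  have hlt : (1 : WithZero (Multiplicative ℤ)) < WithZero.exp 1 := by
    rw [← WithZero.exp_zero, WithZero.exp_lt_exp]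
    exact zero_lt_one
  exact hle.not_gt (lt_mul_of_one_lt_left (zero_lt_one.trans_le hge) hlt)

theorem exists_pow_smul_resolvent_sub_eq_map (F : Matrix ι ι K) (j : ℕ) :
    ∃ Q : Matrix ι ι K[X], (RatFunc.X : RatFunc K) ^ j • (sISub F)⁻¹ -
      (F ^ j).map (algebraMap K (RatFunc K)) * (sISub F)⁻¹ =
        Q.map (algebraMap K[X] (RatFunc K)) := by
  have hcomm : Commute (scalar ι (X : K[X])) ((C : K →+* K[X]).mapMatrix F) :=
    scalar_commute _ (fun _ => Commute.all _ _) _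
  have hgeom := congrArg (algebraMap K[X] (RatFunc K)).mapMatrix (hcomm.geom_sum₂_mul j)
  let Q := ∑ i ∈ Finset.range j, scalar ι (X : K[X]) ^ i *
    (C : K →+* K[X]).mapMatrix F ^ (j - 1 - i)
  refine ⟨Q, ?_⟩
  have hpow : (algebraMap K[X] (RatFunc K)).mapMatrix
      (scalar ι (X : K[X]) ^ j - (C : K →+* K[X]).mapMatrix F ^ j) =
      (RatFunc.X : RatFunc K) ^ j • 1 - (F ^ j).map (algebraMap K (RatFunc K)) := by
    rw [← map_pow, ← map_pow]
    ext i k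
    rcases eq_or_ne i k with rfl | h
    · simp
    · simp [h]
  rw [hpow, map_mul, ← charmatrix, ← sISub_eq_charmatrix_map] at hgeom
  rw [← one_mul (sISub F)⁻¹, ← smul_mul_assoc, one_mul, ← sub_mul, ← hgeom,
    mul_nonsing_inv_cancel_right _ _ (isUnit_det_sISub F), RingHom.mapMatrix_apply]

/-- `π₋(sʲ (sI - F)⁻¹) = Fʲ (sI - F)⁻¹` for every square matrix `F`. -/
theorem map_piMinus_pow_smul_resolvent (F : Matrix ι ι K) (j : ℕ) :
    ((RatFunc.X : RatFunc K) ^ j • (sISub F)⁻¹).map piMinus =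
      (F ^ j).map (algebraMap K (RatFunc K)) * (sISub F)⁻¹ := by
  classical
  obtain ⟨Q, hQ⟩ := exists_pow_smul_resolvent_sub_eq_map F j
  obtain ⟨g, hg, hR⟩ := exists_inftyValuation_resolvent_le F
  ext i k
  exact piMinus_eq_of_sub_eq_algebraMap
    ((inftyValuation_map_mul_apply_le (F ^ j) _ hR i k).trans_lt hg) (congrFun₂ hQ i k)

end Resolvent

/-- `π₋( sʲ (sI - C)⁻¹ ) = Cʲ (sI - C)⁻¹` over `K(s)`, for all `j ≥ 0`. -/
theorem piMinus_pow_smul_resolvent (n : ℕ) (hn : 1 ≤ n) (p : Polynomial K)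
    (hp : p.Monic) (hdeg : p.natDegree = n) (j : ℕ) :
    (((RatFunc.X : RatFunc K) ^ j • (sISub (companion n p))⁻¹).map piMinus) =
      (companion n p ^ j).map (algebraMap K (RatFunc K)) * (sISub (companion n p))⁻¹ := by
  exact map_piMinus_pow_smul_resolvent (companion n p) j

end
end

section
/- Every square matrix A over a field K is similar over K to a block diagonal matrix diag( J(p_1^{k_1}), …, J(p_r^{k_r}) ) for some monic irreducible polynomials p_1, …, p_r ∈ K[s] and positive integers k_1, …, k_r, where the product p_1^{k_1} ⋯ p_r^{k_r} equals the characteristic polynomial of A (Jacobson normal form). -/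
open Polynomial Matrix Kronecker

set_option synthInstance.maxHeartbeats 1000000
set_option maxHeartbeats 1000000

noncomputable section

variable {K : Type*} [Field K]

theorem sum_companion_smul_X_pow {n : ℕ} {p : K[X]} (hp : p.Monic) (hn : p.natDegree = n)
    (i : Fin n) :
    ∑ j, companion n p i j • (X : K[X]) ^ (j : ℕ) =
      X * X ^ (i : ℕ) - if (i : ℕ) + 1 = n then p else 0 := by
  have hi := i.isLt
  split_ifs with h
  · have hrow : ∀ j : Fin n, companion n p i j = -p.coeff j := fun j => by
      have := j.isLt
      simp only [companion, Matrix.of_apply]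
      rw [if_neg (by omega), if_pos (by omega)]
    have hsum := hp.as_sum
    rw [hn, Finset.sum_range] at hsum
    simp only [hrow, neg_smul, Finset.sum_neg_distrib, smul_eq_C_mul]
    rw [← pow_succ', h]
    conv_rhs => rw [hsum]
    ring
  · rw [Finset.sum_eq_single ⟨(i : ℕ) + 1, by omega⟩]
    · simp [companion, pow_succ']
    · intro j _ hj
      have : (i : ℕ) + 1 ≠ j := fun h' => hj (Fin.ext h'.symm)
      simp only [companion, Matrix.of_apply]
      rw [if_neg this, if_neg (by omega), zero_smul]
    · simp

theorem sum_eV_smul_X_pow {n : ℕ} (i : Fin n) :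
    ∑ j, eV K n i j • (X : K[X]) ^ (j : ℕ) = if (i : ℕ) + 1 = n then 1 else 0 := by
  have hi := i.isLt
  rw [Finset.sum_eq_single ⟨0, by omega⟩]
  · simp only [eV, Matrix.of_apply]
    have : (i : ℕ) = n - 1 ↔ (i : ℕ) + 1 = n := by omega
    simp [this]
  · intro j _ hj
    have : (j : ℕ) ≠ 0 := fun h' => hj (Fin.ext h')
    simp [eV, this]
  · simp

theorem sum_supN_smul_pow {k : ℕ} (p : K[X]) (a : Fin k) :
    ∑ b, supN K k a b • p ^ (b : ℕ) = if (a : ℕ) + 1 = k then 0 else p ^ ((a : ℕ) + 1) := by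
  have ha := a.isLt
  split_ifs with h
  · refine Finset.sum_eq_zero fun b _ => ?_
    have := b.isLt
    simp only [supN, Matrix.of_apply]
    rw [if_neg (by omega), zero_smul]
  · rw [Finset.sum_eq_single ⟨(a : ℕ) + 1, by omega⟩]
    · simp [supN]
    · intro b _ hb
      have : (a : ℕ) + 1 ≠ b := fun h' => hb (Fin.ext h'.symm)
      simp [supN, this]
    · simp

theorem sum_kronecker_smul_mul {R m n : Type*} [CommRing R] [Algebra K R] [Fintype m]
    [Fintype n] (M : Matrix m m K) (N : Matrix n n K) (f : m → R) (g : n → R) (c : m × n) :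
    ∑ d, (M ⊗ₖ N) c d • (f d.1 * g d.2) =
      (∑ b, M c.1 b • f b) * ∑ j, N c.2 j • g j := by
  rw [Fintype.sum_prod_type, Finset.sum_mul_sum]
  simp only [Matrix.kroneckerMap_apply, smul_mul_smul_comm]

theorem sum_jacobson_smul {n : ℕ} {p : K[X]} (hp : p.Monic) (hn : p.natDegree = n) {k : ℕ}
    (c : Fin k × Fin n) :
    ∃ q : K[X], ∑ d, jacobson n p k c d • (p ^ (d.1 : ℕ) * X ^ (d.2 : ℕ)) =
      X * (p ^ (c.1 : ℕ) * X ^ (c.2 : ℕ)) - p ^ k * q := by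
  simp only [jacobson, Matrix.add_apply, add_smul, Finset.sum_add_distrib]
  rw [sum_kronecker_smul_mul _ _ (fun a : Fin k => p ^ (a : ℕ))
      (fun i : Fin n => (X : K[X]) ^ (i : ℕ)),
    sum_kronecker_smul_mul _ _ (fun a : Fin k => p ^ (a : ℕ))
      (fun i : Fin n => (X : K[X]) ^ (i : ℕ)),
    sum_companion_smul_X_pow hp hn, sum_eV_smul_X_pow, sum_supN_smul_pow]
  have hone : ∑ b, (1 : Matrix (Fin k) (Fin k) K) c.1 b • p ^ (b : ℕ) = p ^ (c.1 : ℕ) := by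
    simp [Matrix.one_apply, ite_smul]
  rw [hone]
  refine ⟨if (c.2 : ℕ) + 1 = n ∧ (c.1 : ℕ) + 1 = k then 1 else 0, ?_⟩
  by_cases h₁ : (c.2 : ℕ) + 1 = n <;> by_cases h₂ : (c.1 : ℕ) + 1 = k
  · simp only [h₁, h₂, and_self, if_true]
    have hk : p ^ k = p ^ (c.1 : ℕ) * p := by rw [← pow_succ, h₂]
    rw [hk]
    ring
  all_goals
    simp only [h₁, h₂, and_self, and_true, and_false, if_true, if_false]
    ring

theorem exists_jacobson_basis {n : ℕ} {p : K[X]} (hp : p.Monic) (hn : p.natDegree = n)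
    (hpos : 0 < n) (k : ℕ) :
    ∃ b : Module.Basis (Fin k × Fin n) K (AdjoinRoot (p ^ k)),
      ∀ c, AdjoinRoot.root (p ^ k) * b c = ∑ d, jacobson n p k c d • b d := by
  set v : Fin k × Fin n → AdjoinRoot (p ^ k) :=
    fun d => AdjoinRoot.mkₐ (p ^ k) (p ^ (d.1 : ℕ) * X ^ (d.2 : ℕ)) with hv
  have hroot : ∀ c, AdjoinRoot.root (p ^ k) * v c = ∑ d, jacobson n p k c d • v d := by
    intro c
    obtain ⟨q, hq⟩ := sum_jacobson_smul hp hn c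
    have := congrArg (AdjoinRoot.mkₐ (p ^ k)) hq
    rw [map_sum, map_sub, map_mul, map_mul _ (p ^ k)] at this
    simp only [map_smul] at this
    have h₀ : AdjoinRoot.mkₐ (p ^ k) (p ^ k) = 0 := AdjoinRoot.mk_self
    rw [h₀, zero_mul, sub_zero] at this
    exact this.symm
  have hspan : ∀ x, x ∈ Submodule.span K (Set.range v) := by
    rcases Nat.eq_zero_or_pos k with rfl | hk
    · have h₁ : (1 : AdjoinRoot (p ^ 0)) = 0 := by
        have : AdjoinRoot.mk (p ^ 0) (p ^ 0) = 0 := AdjoinRoot.mk_self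
        simpa using this
      intro x
      rw [← mul_one x, h₁, mul_zero]
      exact zero_mem _
    · have hmul : ∀ x ∈ Submodule.span K (Set.range v),
          AdjoinRoot.root (p ^ k) * x ∈ Submodule.span K (Set.range v) := by
        intro x hx
        induction hx using Submodule.span_induction with
        | mem x hx =>
          obtain ⟨c, rfl⟩ := hx
          rw [hroot]
          exact Submodule.sum_mem _ fun d _ =>
            Submodule.smul_mem _ _ (Submodule.subset_span ⟨d, rfl⟩)
        | zero => simp
        | add x y _ _ hx hy => rw [mul_add]; exact add_mem hx hy
        | smul a x _ hx => rw [mul_smul_comm]; exact Submodule.smul_mem _ _ hx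
      have hone : (1 : AdjoinRoot (p ^ k)) ∈ Submodule.span K (Set.range v) :=
        Submodule.subset_span ⟨(⟨0, hk⟩, ⟨0, hpos⟩), by simp [hv]⟩
      have hpow : ∀ m : ℕ, AdjoinRoot.root (p ^ k) ^ m ∈ Submodule.span K (Set.range v) := by
        intro m
        induction m with
        | zero => simpa using hone
        | succ m ih => rw [pow_succ']; exact hmul _ ih
      intro x
      obtain ⟨f, rfl⟩ := AdjoinRoot.mk_surjective x
      rw [← AdjoinRoot.aeval_eq, aeval_eq_sum_range]
      exact Submodule.sum_mem _ fun m _ => Submodule.smul_mem _ _ (hpow m)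
  have hcard : Fintype.card (Fin k × Fin n) = Module.finrank K (AdjoinRoot (p ^ k)) := by
    rw [(AdjoinRoot.powerBasis' (hp.pow k)).finrank]
    simp [hp.natDegree_pow, hn]
  refine ⟨basisOfTopLeSpanOfCardEqFinrank v (fun x _ => hspan x) hcard, ?_⟩
  simpa only [coe_basisOfTopLeSpanOfCardEqFinrank] using hroot

theorem toMatrix_eq_transpose_of_apply_eq_sum {ι M : Type*} [Fintype ι] [DecidableEq ι]
    [AddCommGroup M] [Module K M] (b : Module.Basis ι K M) (f : M →ₗ[K] M) (J : Matrix ι ι K)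
    (h : ∀ c, f (b c) = ∑ d, J c d • b d) : LinearMap.toMatrix b b f = Jᵀ := by
  ext d c
  rw [LinearMap.toMatrix_apply, h, b.repr_sum_self, Matrix.transpose_apply]

theorem charpoly_jacobson {n : ℕ} {p : K[X]} (hp : p.Monic) (hn : p.natDegree = n)
    (hpos : 0 < n) (k : ℕ) : (jacobson n p k).charpoly = p ^ k := by
  obtain ⟨b, hb⟩ := exists_jacobson_basis hp hn hpos k
  let pb := AdjoinRoot.powerBasis' (hp.pow k)
  have : Module.Finite K (AdjoinRoot (p ^ k)) := pb.finite
  have hJ := toMatrix_eq_transpose_of_apply_eq_sum b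
    (Algebra.lmul K (AdjoinRoot (p ^ k)) (AdjoinRoot.root (p ^ k))) _ hb
  have hmin := charpoly_leftMulMatrix pb
  rw [Algebra.leftMulMatrix_apply, LinearMap.charpoly_toMatrix] at hmin
  rw [← Matrix.charpoly_transpose, ← hJ, LinearMap.charpoly_toMatrix]
  refine hmin.trans ?_
  rw [AdjoinRoot.powerBasis'_gen, AdjoinRoot.minpoly_root (hp.pow k).ne_zero,
    (hp.pow k).leadingCoeff]
  simp

theorem charpoly_blockDiagonal' {R o : Type*} [CommRing R] [Fintype o] [LinearOrder o]
    {m : o → Type*} [∀ i, Fintype (m i)] [∀ i, DecidableEq (m i)]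
    (M : ∀ i, Matrix (m i) (m i) R) :
    (Matrix.blockDiagonal' M).charpoly = ∏ i, (M i).charpoly := by
  rw [Matrix.charpoly, (Matrix.blockTriangular_blockDiagonal' M).charmatrix.det_fintype]
  refine Finset.prod_congr rfl fun i _ => ?_
  rw [← Matrix.charmatrix_toSquareBlock, ← Matrix.charpoly,
    ← Matrix.charpoly_reindex (Equiv.sigmaSubtype i)]
  congr 1
  ext a b
  simp [Matrix.toSquareBlock_def, Equiv.sigmaSubtype]

theorem dfinsupp_basis_apply {ι R : Type*} {M η : ι → Type*} [DecidableEq ι] [Semiring R]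
    [∀ i, AddCommMonoid (M i)] [∀ i, Module R (M i)] (b : ∀ i, Module.Basis (η i) R (M i))
    (i : ι) (c : η i) : DFinsupp.basis b ⟨i, c⟩ = DFinsupp.single i (b i c) := by
  apply (DFinsupp.basis b).repr.injective
  rw [Module.Basis.repr_self]
  simp only [DFinsupp.basis, LinearEquiv.trans_apply, DFinsupp.mapRange.linearEquiv_apply,
    DFinsupp.mapRange_single, Module.Basis.repr_self]
  rw [LinearEquiv.eq_symm_apply]
  exact sigmaFinsuppEquivDFinsupp_single (⟨i, c⟩ : Σ i, η i) 1

theorem exists_jacobson_basis_quotient {n : ℕ} {p : K[X]} (hp : p.Monic)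
    (hn : p.natDegree = n) (hpos : 0 < n) (k : ℕ) :
    ∃ b : Module.Basis (Fin k × Fin n) K (K[X] ⧸ Submodule.span K[X] {p ^ k}),
      ∀ c, (X : K[X]) • b c = ∑ d, jacobson n p k c d • b d :=
  exists_jacobson_basis hp hn hpos k

theorem exists_primary_jacobson_basis.{u, v} {K : Type u} [Field K] {M : Type v} [AddCommGroup M] [Module K M]
    [Module.Finite K M] (f : Module.End K M) :
    ∃ (ι : Type u) (_ : Fintype ι) (k : ι → ℕ) (p : ι → K[X]),
      (∀ i, (p i).Monic) ∧ (∀ i, Irreducible (p i)) ∧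
      ∃ B : Module.Basis (Σ i, Fin (k i) × Fin (p i).natDegree) K M,
        ∀ i c, f (B ⟨i, c⟩) = ∑ d, jacobson (p i).natDegree (p i) (k i) c d • B ⟨i, d⟩ := by
  classical
  obtain ⟨ι, hι, q, hq, k, ⟨φ⟩⟩ := Module.equiv_directSum_of_isTorsion
    (R := K[X]) (M := Module.AEval' f) (Module.AEval.isTorsion_of_finiteDimensional K M f)
  have hmonic : ∀ i, (normalize (q i)).Monic := fun i => Polynomial.monic_normalize (hq i).ne_zero
  have hirr : ∀ i, Irreducible (normalize (q i)) := fun i =>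
    (associated_normalize (q i)).irreducible (hq i)
  choose b hb using fun i =>
    exists_jacobson_basis_quotient (hmonic i) rfl (hirr i).natDegree_pos (k i)
  have hspan : ∀ i, Submodule.span K[X] {normalize (q i) ^ k i} =
      Submodule.span K[X] {q i ^ k i} := fun i =>
    Ideal.span_singleton_eq_span_singleton.2 (normalize_associated (q i)).pow_pow
  let ψ := φ.trans (DFinsupp.mapRange.linearEquiv fun i =>
    Submodule.quotEquivOfEq _ _ (hspan i).symm)
  let ψK := (Module.AEval'.of f).trans (ψ.restrictScalars K)
  have hψ : ∀ i (x : K[X] ⧸ Submodule.span K[X] {normalize (q i) ^ k i}),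
      f (ψK.symm (DFinsupp.single i x)) = ψK.symm (DFinsupp.single i ((X : K[X]) • x)) := by
    intro i x
    rw [DFinsupp.single_smul]
    apply (Module.AEval'.of f).injective
    rw [← Module.AEval'.X_smul_of]
    exact (ψ.symm.map_smul X (DFinsupp.single i x)).symm
  refine ⟨ι, hι, k, fun i => normalize (q i), hmonic, hirr,
    (DFinsupp.basis b).map ψK.symm, fun i c => ?_⟩
  simp only [Module.Basis.map_apply, dfinsupp_basis_apply, hψ, hb]
  rw [← DFinsupp.singleAddHom_apply, map_sum, map_sum]
  refine Finset.sum_congr rfl fun d _ => ?_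
  rw [DFinsupp.singleAddHom_apply, DFinsupp.single_smul, map_smul]

theorem exists_jacobson_basis_of_linearMap {M : Type*} [AddCommGroup M] [Module K M]
    [Module.Finite K M] (f : Module.End K M) :
    ∃ (r : ℕ) (k : Fin r → ℕ) (p : Fin r → K[X]),
      (∀ i, (p i).Monic) ∧ (∀ i, Irreducible (p i)) ∧ (∀ i, 1 ≤ k i) ∧
      ∃ B : Module.Basis (Σ i, Fin (k i) × Fin (p i).natDegree) K M,
        ∀ i c, f (B ⟨i, c⟩) = ∑ d, jacobson (p i).natDegree (p i) (k i) c d • B ⟨i, d⟩ := by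
  classical
  obtain ⟨ι, _, k, p, hmonic, hirr, B, hB⟩ := exists_primary_jacobson_basis f
  let σ := (Fintype.equivFin {i // 1 ≤ k i}).symm
  let τ : (Σ s, Fin (k (σ s)) × Fin (p (σ s)).natDegree) →
      Σ i, Fin (k i) × Fin (p i).natDegree := fun x => ⟨σ x.1, x.2⟩
  have hτ : Function.Bijective τ := by
    refine ⟨Function.Injective.sigma_map
      (β₂ := fun i => Fin (k i) × Fin (p i).natDegree) (f₂ := fun _ => id)
      (Subtype.val_injective.comp σ.injective) fun _ => Function.injective_id, ?_⟩
    rintro ⟨i, c⟩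
    obtain ⟨s, hs⟩ := σ.surjective ⟨i, Nat.one_le_of_lt c.1.isLt⟩
    obtain rfl : i = σ s := by rw [hs]
    exact ⟨⟨s, c⟩, rfl⟩
  refine ⟨_, fun s => k (σ s), fun s => p (σ s), fun s => hmonic _, fun s => hirr _,
    fun s => (σ s).2, B.reindex (Equiv.ofBijective τ hτ).symm, fun s c => ?_⟩
  simpa only [Module.Basis.reindex_apply, Equiv.symm_symm, Equiv.ofBijective_apply]
    using hB (σ s) c

/-- Jacobson normal form: every square matrix over a field `K`
is similar over `K` to a block diagonal matrix of Jacobson blocks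
`J(p₁^{k₁}), …, J(p_r^{k_r})`, with `p₁^{k₁} ⋯ p_r^{k_r}` equal to the
characteristic polynomial. -/
theorem exists_jacobson_normal_form (ℓ : ℕ) (A : Matrix (Fin ℓ) (Fin ℓ) K) :
    ∃ (r : ℕ) (np kp : Fin r → ℕ) (p : Fin r → Polynomial K),
      (∀ i, (p i).Monic) ∧ (∀ i, Irreducible (p i)) ∧
      (∀ i, (p i).natDegree = np i) ∧ (∀ i, 1 ≤ kp i) ∧
      (∏ i, p i ^ kp i) = A.charpoly ∧
      ∃ (e : Fin ℓ ≃ (Σ i : Fin r, Fin (kp i) × Fin (np i)))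
        (S : Matrix (Fin ℓ) (Fin ℓ) K),
        IsUnit S.det ∧
        A = S * (Matrix.reindex e.symm e.symm
          (Matrix.blockDiagonal' fun i => jacobson (np i) (p i) (kp i))) * S⁻¹ := by
  obtain ⟨r, k, p, hmonic, hirr, hk, B, hB⟩ := exists_jacobson_basis_of_linearMap (Matrix.toLin' Aᵀ)
  set J := Matrix.blockDiagonal' fun i => jacobson (p i).natDegree (p i) (k i) with hJ
  have hBJ : ∀ c, Matrix.toLin' Aᵀ (B c) = ∑ d, J c d • B d := by
    rintro ⟨i, c⟩
    rw [hB, Fintype.sum_sigma, Finset.sum_eq_single i]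
    · simp [hJ]
    · intro j _ hj
      simp [hJ, Matrix.blockDiagonal'_apply_ne _ _ _ hj.symm]
    · simp
  have hchar : ∏ i, p i ^ k i = A.charpoly := by
    have hT := toMatrix_eq_transpose_of_apply_eq_sum B _ J hBJ
    rw [← Matrix.charpoly_transpose A, ← Matrix.charpoly_toLin' Aᵀ,
      ← LinearMap.charpoly_toMatrix _ B, hT, Matrix.charpoly_transpose, hJ,
      charpoly_blockDiagonal']
    exact Finset.prod_congr rfl fun i _ =>
      (charpoly_jacobson (hmonic i) rfl (hirr i).natDegree_pos (k i)).symm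
  let e := (Pi.basisFun K (Fin ℓ)).indexEquiv B
  let P : Matrix (Fin ℓ) (Fin ℓ) K := Matrix.of fun a => B (e a)
  have hP : IsUnit P.det := by
    let := (Pi.basisFun K (Fin ℓ)).invertibleToMatrix (B.reindex e.symm)
    have := Matrix.isUnit_det_of_invertible
      ((Pi.basisFun K (Fin ℓ)).toMatrix (B.reindex e.symm))
    rw [← Matrix.det_transpose] at this
    convert this using 2
    ext a l
    simp [P, Module.Basis.toMatrix_apply]
  have hPA : P * A = Matrix.reindex e.symm e.symm J * P := by
    ext a l
    have := congrFun (hBJ (e a)) l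
    rw [Matrix.toLin'_apply, Matrix.mulVec_transpose, Finset.sum_apply, ← e.sum_comp] at this
    exact this
  refine ⟨r, fun i => (p i).natDegree, k, p, hmonic, hirr, fun _ => rfl, hk, hchar, e, P⁻¹,
    Matrix.isUnit_nonsing_inv_det P hP, ?_⟩
  rw [Matrix.nonsing_inv_nonsing_inv P hP, Matrix.mul_assoc, ← hPA,
    Matrix.nonsing_inv_mul_cancel_left P A hP]

end
end
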